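/- Let p>2, let N≥1 be an integer, and let h_0∈C([0,1],ℝ) be such that for every r∈[0,1], S_p(h_0)'(r)=0 implies h_0(r)≠0. Then there exists a neighborhood V_0 of h_0 in (C([0,1],ℝ),|·|_0) such that: (a) for every h∈V_0 the function r↦|S_p(h)'(r)|^{2−p} belongs to L^1(0,1), and the map h↦|S_p(h)'|^{2−p} from V_0 into L^1(0,1) is continuous; (b) S_p restricted to V_0 is continuously Fréchet differentiable as a map into (C([0,1],ℝ),|·|_0), with derivative (DS_p(h)h̄)(r) = p* ∫_r^1 |S_p(h)'(s)|^{2−p} J(h̄)(s) ds for all h∈V_0, h̄∈C([0,1],ℝ); (c) each v:=DS_p(h)h̄ is absolutely continuous: v(r)=v(0)+∫_0^r g(t)dt where g(t):=−p*|S_p(h)'(t)|^{2−p}J(h̄)(t) belongs to L^1(0,1). -/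

import Mathlib

open Set MeasureTheory Filter Topology intervalIntegral

noncomputable section

/-- `phi p ξ = |ξ|^(p-2) ξ`, the function `φ_p`. -/
def phi (p ξ : ℝ) : ℝ := |ξ| ^ (p - 2) * ξ

/-- The (one-sided at endpoints) derivative of a function on `[0,1]`. -/
def deriv01 (u : ℝ → ℝ) (r : ℝ) : ℝ := derivWithin u (Set.Icc 0 1) r

/-- `u ∈ C^1([0,1],ℝ)`. -/
def C1on01 (u : ℝ → ℝ) : Prop :=
  (∀ r ∈ Set.Icc (0:ℝ) 1, DifferentiableWithinAt ℝ u (Set.Icc 0 1) r) ∧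
  ContinuousOn (deriv01 u) (Set.Icc 0 1)

/-- `J(h)(s) = ∫_0^s (t/s)^(N-1) h(t) dt`, with `J(h)(0) = 0`. -/
def Jmap (N : ℕ) (h : ℝ → ℝ) (s : ℝ) : ℝ :=
  if s = 0 then 0 else ∫ t in (0:ℝ)..s, (t / s) ^ (N - 1) * h t

/-- `S_p(h)(r) = ∫_r^1 φ_{p'}(J(h)(s)) ds` where `p' = p/(p-1)`. -/
def Sp (p : ℝ) (N : ℕ) (h : ℝ → ℝ) (r : ℝ) : ℝ :=
  ∫ s in r..(1:ℝ), phi (p / (p - 1)) (Jmap N h s)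

/-- The sup norm over `[0,1]`. -/
def norm0 (h : ℝ → ℝ) : ℝ := sSup ((fun t => |h t|) '' Set.Icc 0 1)

/-- `u` is not identically zero on `[0,1]`. -/
def Nontriv01 (u : ℝ → ℝ) : Prop := ∃ r ∈ Set.Icc (0:ℝ) 1, u r ≠ 0

/-- `(lam, u)` is a solution of problem (P):
`-(r^(N-1) φ_p(u'))' = lam r^(N-1) f(r, u(r))` on `(0,1)`, `u'(0) = u(1) = 0`. -/
def IsSolutionP (p : ℝ) (N : ℕ) (f : ℝ → ℝ → ℝ) (lam : ℝ) (u : ℝ → ℝ) : Prop :=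
  C1on01 u ∧ C1on01 (fun r => phi p (deriv01 u r)) ∧
  (∀ r ∈ Set.Ioo (0:ℝ) 1,
      HasDerivAt (fun s => s ^ (N - 1) * phi p (deriv01 u s))
        (-(lam * r ^ (N - 1) * f r (u r))) r) ∧
  deriv01 u 0 = 0 ∧ u 1 = 0

/-- `(lam, v)` is a principal eigenpair for the weight `w`. -/
def IsPrincipalEigenpair (p : ℝ) (N : ℕ) (w : ℝ → ℝ) (lam : ℝ) (v : ℝ → ℝ) : Prop :=
  0 < lam ∧ C1on01 v ∧ C1on01 (fun r => phi p (deriv01 v r)) ∧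
  (∀ r ∈ Set.Ico (0:ℝ) 1, 0 < v r) ∧
  (∀ r ∈ Set.Ioo (0:ℝ) 1,
      HasDerivAt (fun s => s ^ (N - 1) * phi p (deriv01 v s))
        (-(lam * r ^ (N - 1) * w r * phi p (v r))) r) ∧
  deriv01 v 0 = 0 ∧ v 1 = 0

/-- Extension of a continuous function on `[0,1]` to `ℝ` (constant outside `[0,1]`). -/
def extCI (g : C(Set.Icc (0:ℝ) 1, ℝ)) : ℝ → ℝ := Set.IccExtend zero_le_one ⇑g


lemma abs_phi {p : ℝ} (hp : 2 < p) (x : ℝ) :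
    |phi (p / (p - 1)) x| = |x| ^ (1 / (p - 1)) := by
  have hp1 : p - 1 ≠ 0 := by linarith
  unfold phi
  rw [abs_mul, abs_of_nonneg (Real.rpow_nonneg (abs_nonneg x) _)]
  rcases eq_or_ne x 0 with rfl | hx
  · rw [abs_zero, mul_zero, Real.zero_rpow (one_div_ne_zero hp1)]
  · rw [← Real.rpow_add_one (abs_ne_zero.mpr hx)]
    congr 1
    field_simp
    ring

lemma abs_phi_rpow {p : ℝ} (hp : 2 < p) (x : ℝ) :
    |phi (p / (p - 1)) x| ^ (2 - p) = |x| ^ (1 / (p - 1) - 1) := by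
  have hp1 : p - 1 ≠ 0 := by linarith
  rw [abs_phi hp, ← Real.rpow_mul (abs_nonneg x)]
  congr 1
  field_simp
  ring

lemma phi_eq {p : ℝ} (hp : 2 < p) (x : ℝ) :
    phi (p / (p - 1)) x = |x| ^ (1 / (p - 1) - 1) * x := by
  have hp1 : p - 1 ≠ 0 := by linarith
  unfold phi
  congr 2
  field_simp
  ring

lemma continuous_phi {p : ℝ} (hp : 2 < p) : Continuous (phi (p / (p - 1))) := by
  have hα : 0 < 1 / (p - 1) := one_div_pos.mpr (by linarith)
  rw [continuous_iff_continuousAt]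
  intro x
  rcases eq_or_ne x 0 with rfl | hx
  · have h0 : phi (p / (p - 1)) 0 = 0 := by simp [phi]
    rw [ContinuousAt, h0]
    refine squeeze_zero_norm (a := fun x : ℝ => |x| ^ (1 / (p - 1)))
      (fun x => (abs_phi hp x).le) ?_
    have : ContinuousAt (fun x : ℝ => |x| ^ (1 / (p - 1))) 0 :=
      continuousAt_id.abs.rpow_const (Or.inr hα.le)
    simpa only [ContinuousAt, abs_zero, Real.zero_rpow hα.ne', id] using this
  · exact (continuousAt_id.abs.rpow_const (Or.inl (abs_ne_zero.mpr hx))).mul continuousAt_id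

/-- Hölder estimate for the singular power `|x| ^ (-q)`. -/
lemma rpow_neg_sub_rpow_neg_le {q θ a b : ℝ} (hq1 : q ≤ 1) (hθ : 0 ≤ θ)
    (hθ1 : θ ≤ 1) (ha : 0 < a) (hab : a ≤ b) :
    a ^ (-q) - b ^ (-q) ≤ (b - a) ^ θ * a ^ (-q - θ) := by
  have hb : 0 < b := ha.trans_le hab
  have h1 : a / b ≤ (a / b) ^ q := by
    simpa using Real.rpow_le_rpow_of_exponent_ge (div_pos ha hb) ((div_le_one hb).2 hab) hq1
  have h2 : (b - a) / b ≤ ((b - a) / b) ^ θ := by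
    simpa using Real.rpow_le_rpow_of_exponent_ge_of_imp
      (div_nonneg (sub_nonneg.2 hab) hb.le) ((div_le_one hb).2 (by linarith)) hθ1
      (fun _ h => by linarith)
  have h3 : ((b - a) / b) ^ θ ≤ ((b - a) / a) ^ θ :=
    Real.rpow_le_rpow (div_nonneg (sub_nonneg.2 hab) hb.le)
      (div_le_div_of_nonneg_left (sub_nonneg.2 hab) ha hab) hθ
  have h4 : a ^ (-q) - b ^ (-q) = a ^ (-q) * (1 - (a / b) ^ q) := by
    rw [mul_sub, Real.div_rpow ha.le hb.le, Real.rpow_neg ha.le, Real.rpow_neg hb.le]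
    have := (Real.rpow_pos_of_pos ha q).ne'
    field_simp
  have h5 : (b - a) / b = 1 - a / b := by field_simp
  have h6 : (b - a) ^ θ * a ^ (-q - θ) = a ^ (-q) * ((b - a) / a) ^ θ := by
    rw [Real.div_rpow (sub_nonneg.2 hab) ha.le, Real.rpow_sub ha]
    ring
  rw [h4, h6]
  exact mul_le_mul_of_nonneg_left (by linarith) (Real.rpow_nonneg ha.le _)

lemma abs_rpow_neg_sub_le {q θ : ℝ} (hq : 0 < q) (hq1 : q ≤ 1) (hθ : 0 < θ) (hθ1 : θ ≤ 1)
    (a b : ℝ) :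
    |(|a| ^ (-q) - |b| ^ (-q))| ≤ |a - b| ^ θ * (|a| ^ (-q - θ) + |b| ^ (-q - θ)) := by
  wlog hab : |a| ≤ |b| generalizing a b
  · have := this b a (le_of_not_ge hab)
    rwa [abs_sub_comm, abs_sub_comm a b, add_comm (|a| ^ _)]
  have hpos : ∀ x : ℝ, ∀ e : ℝ, 0 ≤ |x| ^ e := fun x e => Real.rpow_nonneg (abs_nonneg x) e
  rcases eq_or_ne a 0 with rfl | ha
  · rw [abs_zero, Real.zero_rpow (neg_ne_zero.2 hq.ne'), zero_sub, zero_sub, abs_neg, abs_neg,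
      Real.zero_rpow (by linarith), zero_add, abs_of_nonneg (hpos _ _)]
    rcases eq_or_ne b 0 with rfl | hb
    · rw [abs_zero, Real.zero_rpow (neg_ne_zero.2 hq.ne'), Real.zero_rpow hθ.ne', zero_mul]
    · rw [← Real.rpow_add (abs_pos.2 hb)]
      simp
  · have ha' := abs_pos.2 ha
    have h1 := rpow_neg_sub_rpow_neg_le hq1 hθ.le hθ1 ha' hab
    have h2 : |b| ^ (-q) ≤ |a| ^ (-q) :=
      Real.rpow_le_rpow_of_nonpos ha' hab (by linarith)
    have h3 : (|b| - |a|) ^ θ ≤ |a - b| ^ θ :=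
      Real.rpow_le_rpow (sub_nonneg.2 hab) (by rw [abs_sub_comm]; exact abs_sub_abs_le_abs_sub b a)
        hθ.le
    rw [abs_of_nonneg (sub_nonneg.2 h2)]
    calc _ ≤ _ := h1
      _ ≤ |a - b| ^ θ * |a| ^ (-q - θ) := mul_le_mul_of_nonneg_right h3 (hpos _ _)
      _ ≤ _ := mul_le_mul_of_nonneg_left (le_add_of_nonneg_right (hpos _ _)) (hpos _ _)

lemma abs_rpow_sub_taylor_le {α x : ℝ} (hα : 0 < α) (hα1 : α < 1) (hx : 0 ≤ x) :
    |x ^ α - 1 - α * (x - 1)| ≤ (x - 1) ^ 2 := by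
  have hu : x ^ α ≤ 1 + α * (x - 1) := by
    simpa using rpow_one_add_le_one_add_mul_self (s := x - 1) (by linarith) hα.le hα1.le
  have hl : x ^ (1 - α) ≤ 1 + (1 - α) * (x - 1) := by
    simpa using rpow_one_add_le_one_add_mul_self (s := x - 1) (p := 1 - α)
      (by linarith) (by linarith) (by linarith)
  have hmul : x ^ α * x ^ (1 - α) = x := by
    rw [← Real.rpow_add_of_nonneg hx hα.le (by linarith)]
    simp
  have h0 : 0 ≤ x ^ α := Real.rpow_nonneg hx _
  have hd : 0 < 1 + (1 - α) * (x - 1) := by nlinarith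
  have h1 : x ≤ x ^ α * (1 + (1 - α) * (x - 1)) :=
    hmul.symm.le.trans (mul_le_mul_of_nonneg_left hl h0)
  have h2 : 1 + α * (x - 1) - x ^ α ≤ (x - 1) ^ 2 := by
    refine le_of_mul_le_mul_right ?_ hd
    have h3 : α * (1 - α) * (x - 1) ^ 2 ≤ (x - 1) ^ 2 * (1 + (1 - α) * (x - 1)) := by
      have : α * (1 - α) ≤ 1 + (1 - α) * (x - 1) := by nlinarith
      rw [mul_comm]
      exact mul_le_mul_of_nonneg_left this (sq_nonneg _)
    nlinarith
  rw [abs_le]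
  constructor <;> linarith [sq_nonneg (x - 1)]

lemma abs_phi_sub_taylor_one_le {α θ : ℝ} (hα : 0 < α) (hα1 : α < 1) (hθ : 0 ≤ θ) (hθ1 : θ ≤ 1)
    (x : ℝ) :
    |(|x| ^ (α - 1) * x - 1 - α * (x - 1))| ≤ 5 * |x - 1| ^ (1 + θ) := by
  have hpow : ∀ {y : ℝ}, 0 ≤ y → |y| ^ (α - 1) * y = y ^ α := by
    intro y hy
    rcases hy.eq_or_lt with rfl | hy'
    · simp [Real.zero_rpow hα.ne']
    · rw [abs_of_pos hy', ← Real.rpow_add_one hy'.ne']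
      simp
  rcases le_total |x - 1| 1 with h | h
  · have hx : 0 ≤ x := by linarith [(abs_le.1 h).1]
    rw [hpow hx]
    calc _ ≤ (x - 1) ^ 2 := abs_rpow_sub_taylor_le hα hα1 hx
      _ = |x - 1| ^ (2 : ℝ) := by rw [← sq_abs, ← Real.rpow_natCast]; norm_num
      _ ≤ |x - 1| ^ (1 + θ) := Real.rpow_le_rpow_of_exponent_ge_of_imp (abs_nonneg _) h
          (by linarith) (fun _ h => by linarith)
      _ ≤ _ := by linarith [Real.rpow_nonneg (abs_nonneg (x - 1)) (1 + θ)]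
  · have h1 : |x - 1| ≤ |x - 1| ^ (1 + θ) := by
      simpa using Real.rpow_le_rpow_of_exponent_le h (show 1 ≤ 1 + θ by linarith)
    have h2 : |(|x| ^ (α - 1) * x)| ≤ 1 + |x| := by
      rw [abs_mul, abs_of_nonneg (Real.rpow_nonneg (abs_nonneg x) _)]
      have := hpow (abs_nonneg x)
      rw [abs_abs] at this
      rw [this]
      have := rpow_one_add_le_one_add_mul_self (s := |x| - 1) (by linarith [abs_nonneg x])
        hα.le hα1.le
      rw [add_sub_cancel] at this
      nlinarith [abs_nonneg x]
    have h3 : |x| ≤ 1 + |x - 1| := by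
      have := abs_add_le (x - 1) 1
      simp at this
      linarith
    have h4 : |(|x| ^ (α - 1) * x - 1 - α * (x - 1))| ≤
        |(|x| ^ (α - 1) * x)| + 1 + α * |x - 1| := by
      refine (abs_sub _ _).trans ?_
      rw [abs_mul α, abs_of_pos hα]
      gcongr
      simpa using abs_sub (|x| ^ (α - 1) * x) 1
    nlinarith [abs_nonneg (x - 1)]

/-- First-order Taylor estimate for `x ↦ |x| ^ (α - 1) * x` at a point `a ≠ 0`. -/
lemma abs_phi_sub_taylor_le {α θ : ℝ} (hα : 0 < α) (hα1 : α < 1) (hθ : 0 ≤ θ) (hθ1 : θ ≤ 1)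
    {a : ℝ} (ha : a ≠ 0) (b : ℝ) :
    |(|b| ^ (α - 1) * b - |a| ^ (α - 1) * a - α * (|a| ^ (α - 1) * (b - a)))| ≤
      5 * (|b - a| ^ (1 + θ) * |a| ^ (α - 1 - θ)) := by
  obtain ⟨x, rfl⟩ : ∃ x, b = a * x := ⟨b / a, by field_simp⟩
  have ha' := abs_pos.2 ha
  have e1 : |a * x| ^ (α - 1) * (a * x) - |a| ^ (α - 1) * a
        - α * (|a| ^ (α - 1) * (a * x - a)) =
      |a| ^ (α - 1) * a * (|x| ^ (α - 1) * x - 1 - α * (x - 1)) := by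
    rw [abs_mul, Real.mul_rpow (abs_nonneg _) (abs_nonneg _)]
    ring
  have e2 : |a * x - a| ^ (1 + θ) * |a| ^ (α - 1 - θ) = |a| ^ α * |x - 1| ^ (1 + θ) := by
    rw [show a * x - a = a * (x - 1) by ring, abs_mul,
      Real.mul_rpow (abs_nonneg _) (abs_nonneg _), mul_right_comm, ← Real.rpow_add ha']
    congr 2
    ring
  have e3 : |(|a| ^ (α - 1) * a)| = |a| ^ α := by
    rw [abs_mul, abs_of_nonneg (Real.rpow_nonneg ha'.le _), ← Real.rpow_add_one ha'.ne']
    simp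
  rw [e1, e2, abs_mul, e3, mul_left_comm]
  exact mul_le_mul_of_nonneg_left (abs_phi_sub_taylor_one_le hα hα1 hθ hθ1 x)
    (Real.rpow_nonneg ha'.le _)

lemma continuous_extCI (h : C(Set.Icc (0:ℝ) 1, ℝ)) : Continuous (extCI h) :=
  h.continuous.Icc_extend'

lemma extCI_sub (g h : C(Set.Icc (0:ℝ) 1, ℝ)) (t : ℝ) :
    extCI (g - h) t = extCI g t - extCI h t := rfl

lemma extCI_add (g h : C(Set.Icc (0:ℝ) 1, ℝ)) (t : ℝ) :
    extCI (g + h) t = extCI g t + extCI h t := rfl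

lemma extCI_smul (c : ℝ) (h : C(Set.Icc (0:ℝ) 1, ℝ)) (t : ℝ) :
    extCI (c • h) t = c * extCI h t := rfl

lemma abs_extCI_le (h : C(Set.Icc (0:ℝ) 1, ℝ)) (t : ℝ) : |extCI h t| ≤ ‖h‖ :=
  h.norm_coe_le_norm _

lemma Jmap_eq_mul_integral (N : ℕ) (h : ℝ → ℝ) (s : ℝ) :
    Jmap N h s = s * ∫ τ in (0:ℝ)..1, τ ^ (N - 1) * h (s * τ) := by
  unfold Jmap
  split_ifs with hs
  · rw [hs, zero_mul]
  · have := intervalIntegral.smul_integral_comp_mul_left (a := 0) (b := 1)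
      (fun t => (t / s) ^ (N - 1) * h t) s
    simp only [mul_zero, mul_one, smul_eq_mul, mul_div_cancel_left₀ _ hs] at this
    exact this.symm

lemma continuous_pow_mul_extCI (N : ℕ) (h : C(Set.Icc (0:ℝ) 1, ℝ)) (s : ℝ) :
    Continuous fun τ : ℝ => τ ^ (N - 1) * extCI h (s * τ) :=
  (continuous_id.pow _).mul ((continuous_extCI h).comp (continuous_const.mul continuous_id))

lemma continuous_Jmap (N : ℕ) (h : C(Set.Icc (0:ℝ) 1, ℝ)) : Continuous (Jmap N (extCI h)) := by
  rw [funext (Jmap_eq_mul_integral N (extCI h))]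
  refine continuous_id.mul
    (intervalIntegral.continuous_parametric_intervalIntegral_of_continuous' ?_ 0 1)
  exact (continuous_snd.pow _).mul
    ((continuous_extCI h).comp (continuous_fst.mul continuous_snd))

lemma Jmap_add (N : ℕ) (g h : C(Set.Icc (0:ℝ) 1, ℝ)) (s : ℝ) :
    Jmap N (extCI (g + h)) s = Jmap N (extCI g) s + Jmap N (extCI h) s := by
  simp only [Jmap_eq_mul_integral, extCI_add, mul_add]
  rw [intervalIntegral.integral_add ((continuous_pow_mul_extCI N g s).intervalIntegrable _ _)
    ((continuous_pow_mul_extCI N h s).intervalIntegrable _ _), mul_add]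

lemma Jmap_smul (N : ℕ) (c : ℝ) (h : C(Set.Icc (0:ℝ) 1, ℝ)) (s : ℝ) :
    Jmap N (extCI (c • h)) s = c * Jmap N (extCI h) s := by
  simp only [Jmap_eq_mul_integral, extCI_smul, mul_left_comm _ c]
  rw [intervalIntegral.integral_const_mul, mul_left_comm]

lemma Jmap_sub (N : ℕ) (g h : C(Set.Icc (0:ℝ) 1, ℝ)) (s : ℝ) :
    Jmap N (extCI (g - h)) s = Jmap N (extCI g) s - Jmap N (extCI h) s := by
  rw [eq_sub_iff_add_eq, ← Jmap_add, sub_add_cancel]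

lemma abs_Jmap_le (N : ℕ) (h : C(Set.Icc (0:ℝ) 1, ℝ)) {s : ℝ} (hs : s ∈ Set.Icc (0:ℝ) 1) :
    |Jmap N (extCI h) s| ≤ ‖h‖ := by
  have h1 : ‖∫ τ in (0:ℝ)..1, τ ^ (N - 1) * extCI h (s * τ)‖ ≤ ‖h‖ * |(1:ℝ) - 0| := by
    refine intervalIntegral.norm_integral_le_of_norm_le_const fun τ hτ => ?_
    rw [Set.uIoc_of_le zero_le_one] at hτ
    rw [norm_mul, norm_pow, Real.norm_of_nonneg hτ.1.le]
    calc τ ^ (N - 1) * ‖extCI h (s * τ)‖ ≤ 1 * ‖h‖ :=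
          mul_le_mul (pow_le_one₀ hτ.1.le hτ.2) (abs_extCI_le h _) (norm_nonneg _) zero_le_one
      _ = ‖h‖ := one_mul _
  rw [sub_zero, abs_one, mul_one, Real.norm_eq_abs] at h1
  rw [Jmap_eq_mul_integral, abs_mul, abs_of_nonneg hs.1]
  calc _ ≤ 1 * ‖h‖ := mul_le_mul hs.2 h1 (abs_nonneg _) zero_le_one
    _ = ‖h‖ := one_mul _

lemma continuous_phi_Jmap {p : ℝ} (hp : 2 < p) (N : ℕ) (h : C(Set.Icc (0:ℝ) 1, ℝ)) :
    Continuous fun s => phi (p / (p - 1)) (Jmap N (extCI h) s) :=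
  (continuous_phi hp).comp (continuous_Jmap N h)

lemma hasDerivAt_Sp {p : ℝ} (hp : 2 < p) (N : ℕ) (h : C(Set.Icc (0:ℝ) 1, ℝ)) (r : ℝ) :
    HasDerivAt (Sp p N (extCI h)) (-phi (p / (p - 1)) (Jmap N (extCI h) r)) r :=
  intervalIntegral.integral_hasDerivAt_left
    ((continuous_phi_Jmap hp N h).intervalIntegrable _ _)
    ((continuous_phi_Jmap hp N h).stronglyMeasurableAtFilter _ _)
    (continuous_phi_Jmap hp N h).continuousAt

lemma deriv01_Sp {p : ℝ} (hp : 2 < p) (N : ℕ) (h : C(Set.Icc (0:ℝ) 1, ℝ)) {r : ℝ}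
    (hr : r ∈ Set.Icc (0:ℝ) 1) :
    deriv01 (Sp p N (extCI h)) r = -phi (p / (p - 1)) (Jmap N (extCI h) r) :=
  (hasDerivAt_Sp hp N h r).hasDerivWithinAt.derivWithin (uniqueDiffOn_Icc zero_lt_one r hr)

lemma abs_deriv01_Sp_rpow {p : ℝ} (hp : 2 < p) (N : ℕ) (h : C(Set.Icc (0:ℝ) 1, ℝ)) {r : ℝ}
    (hr : r ∈ Set.Icc (0:ℝ) 1) :
    |deriv01 (Sp p N (extCI h)) r| ^ (2 - p) = |Jmap N (extCI h) r| ^ (1 / (p - 1) - 1) := by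
  rw [deriv01_Sp hp N h hr, abs_neg, abs_phi_rpow hp]

lemma pow_mul_Jmap (N : ℕ) (h : ℝ → ℝ) {s : ℝ} (hs : s ≠ 0) :
    s ^ (N - 1) * Jmap N h s = ∫ t in (0:ℝ)..s, t ^ (N - 1) * h t := by
  rw [Jmap, if_neg hs, ← intervalIntegral.integral_const_mul]
  congr 1 with t
  rw [div_pow, ← mul_assoc, mul_div_cancel₀ _ (pow_ne_zero _ hs)]

lemma abs_integral_pow_mul_le_abs_Jmap (N : ℕ) (h : ℝ → ℝ) {s : ℝ} (hs : s ∈ Set.Icc (0:ℝ) 1) :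
    |∫ t in (0:ℝ)..s, t ^ (N - 1) * h t| ≤ |Jmap N h s| := by
  rcases eq_or_ne s 0 with rfl | h0
  · simp
  · rw [← pow_mul_Jmap N h h0, abs_mul, abs_of_nonneg (pow_nonneg hs.1 _)]
    exact mul_le_of_le_one_left (abs_nonneg _) (pow_le_one₀ hs.1 hs.2)

/-- If `F` expands distances on a compact set by a factor `c`, it dominates a multiple of the
distance to some point of that set. -/
lemma exists_mul_abs_sub_le {F : ℝ → ℝ} {U : Set ℝ} {c : ℝ} (hU : IsCompact U) (hne : U.Nonempty)
    (hF : ContinuousOn F U) (hc : ∀ s ∈ U, ∀ t ∈ U, t ≤ s → c * (s - t) ≤ |F s - F t|) :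
    ∃ w ∈ U, ∀ s ∈ U, c / 2 * |s - w| ≤ |F s| := by
  obtain ⟨w, hw, hmin⟩ := hU.exists_isMinOn hne hF.abs
  refine ⟨w, hw, fun s hs => ?_⟩
  have h1 : |F w| ≤ |F s| := hmin hs
  have h2 := abs_sub (F s) (F w)
  rcases le_total w s with h | h
  · have := hc s hs w hw h
    rw [abs_of_nonneg (sub_nonneg.2 h)]
    linarith
  · have := hc w hw s hs h
    rw [abs_sub_comm] at this
    rw [abs_of_nonpos (sub_nonpos.2 h)]
    linarith

/-- Near each point of `[0,1]`, `J(h)` is bounded below by a multiple of the distance to some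
point, uniformly for `h` close to a nondegenerate `h₀`. -/
lemma exists_local_lower_bound (N : ℕ) (h₀ : C(Set.Icc (0:ℝ) 1, ℝ)) {z : ℝ}
    (hz : z ∈ Set.Icc (0:ℝ) 1) (hnd : Jmap N (extCI h₀) z = 0 → extCI h₀ z ≠ 0) :
    ∃ δ > 0, ∃ c > 0, ∀ h : C(Set.Icc (0:ℝ) 1, ℝ), ‖h - h₀‖ < δ → ∃ w ∈ Set.Icc (0:ℝ) 1,
      ∀ s ∈ Set.Icc (0:ℝ) 1, |s - z| < δ → c * |s - w| ≤ |Jmap N (extCI h) s| := by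
  by_cases hJ : Jmap N (extCI h₀) z = 0
  swap
  · set c := |Jmap N (extCI h₀) z| / 3 with hc
    have hc0 : 0 < c := div_pos (abs_pos.2 hJ) three_pos
    obtain ⟨δ, hδ, hδc⟩ := Metric.continuousAt_iff.1 (continuous_Jmap N h₀).continuousAt c hc0
    refine ⟨min δ c, lt_min hδ hc0, c, hc0, fun h hh => ⟨z, hz, fun s hs hsz => ?_⟩⟩
    have h1 : |Jmap N (extCI h₀) s - Jmap N (extCI h₀) z| < c :=
      hδc (x := s) (hsz.trans_le (min_le_left _ _))
    have h2 : |Jmap N (extCI h) s - Jmap N (extCI h₀) s| < c := by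
      rw [← Jmap_sub]
      exact (abs_Jmap_le N _ hs).trans_lt (hh.trans_le (min_le_right _ _))
    have h3 : |s - z| ≤ 1 := abs_le.2 ⟨by linarith [hs.1, hz.2], by linarith [hs.2, hz.1]⟩
    have h4 : |Jmap N (extCI h₀) z| ≤ |Jmap N (extCI h) s|
        + |Jmap N (extCI h) s - Jmap N (extCI h₀) s|
        + |Jmap N (extCI h₀) s - Jmap N (extCI h₀) z| := by
      have := abs_sub_abs_le_abs_sub (Jmap N (extCI h₀) z) (Jmap N (extCI h) s)
      have h5 := abs_sub_le (Jmap N (extCI h) s) (Jmap N (extCI h₀) s) (Jmap N (extCI h₀) z)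
      rw [abs_sub_comm] at this
      linarith
    nlinarith
  · have hne := hnd hJ
    set c := |extCI h₀ z| / 3 with hc
    have hc0 : 0 < c := div_pos (abs_pos.2 hne) three_pos
    obtain ⟨δ, hδ, hδc⟩ := Metric.continuousAt_iff.1 (continuous_extCI h₀).continuousAt c hc0
    obtain ⟨σ, hσ, hσz⟩ : ∃ σ : ℝ, |σ| = 1 ∧ σ * extCI h₀ z = 3 * c := by
      rcases le_total 0 (extCI h₀ z) with h | h
      · exact ⟨1, abs_one, by rw [hc, abs_of_nonneg h]; ring⟩
      · exact ⟨-1, by simp, by rw [hc, abs_of_nonpos h]; ring⟩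
    have key : ∀ h : C(Set.Icc (0:ℝ) 1, ℝ), ‖h - h₀‖ < c → ∀ t, |t - z| < δ →
        c ≤ σ * extCI h t := by
      intro h hh t ht
      have h1 : |extCI h₀ t - extCI h₀ z| < c := hδc (x := t) ht
      have h2 : |extCI h t - extCI h₀ t| < c :=
        (extCI_sub h h₀ t ▸ abs_extCI_le (h - h₀) t).trans_lt hh
      have h3 : |σ * (extCI h₀ z - extCI h t)| ≤ 2 * c := by
        rw [abs_mul, hσ, one_mul, abs_sub_comm]
        linarith [abs_sub_le (extCI h t) (extCI h₀ t) (extCI h₀ z)]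
      have := (abs_le.1 h3).2
      rw [mul_sub] at this
      linarith
    rcases hz.1.eq_or_lt with rfl | hz0
    · refine ⟨min δ c, lt_min hδ hc0, c * ∫ τ in (0:ℝ)..1, τ ^ (N - 1),
        mul_pos hc0 (by rw [integral_pow]; simp; positivity),
        fun h hh => ⟨0, hz, fun s hs hsz => ?_⟩⟩
      have h1 : c * ∫ τ in (0:ℝ)..1, τ ^ (N - 1) ≤
          σ * ∫ τ in (0:ℝ)..1, τ ^ (N - 1) * extCI h (s * τ) := by
        rw [← intervalIntegral.integral_const_mul, ← intervalIntegral.integral_const_mul]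
        refine intervalIntegral.integral_mono_on zero_le_one
          ((continuous_const.mul (continuous_pow _)).intervalIntegrable _ _)
          ((continuous_const.mul (continuous_pow_mul_extCI N h s)).intervalIntegrable _ _)
          fun τ hτ => ?_
        rw [mul_left_comm σ, mul_comm c]
        refine mul_le_mul_of_nonneg_left (key h (hh.trans_le (min_le_right _ _)) _ ?_)
          (pow_nonneg hτ.1 _)
        rw [sub_zero] at hsz ⊢
        rw [abs_mul, abs_of_nonneg hτ.1]
        exact (mul_le_of_le_one_right (abs_nonneg _) hτ.2).trans_lt
          (hsz.trans_le (min_le_left _ _))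
      rw [Jmap_eq_mul_integral, abs_mul, sub_zero, mul_comm]
      refine mul_le_mul_of_nonneg_left (h1.trans ((le_abs_self _).trans ?_)) (abs_nonneg _)
      rw [abs_mul, hσ, one_mul]
    · set d := min (min (δ / 2) c) (z / 2) with hd
      have hd0 : 0 < d := lt_min (lt_min (half_pos hδ) hc0) (half_pos hz0)
      have hdδ : d < δ := ((min_le_left _ _).trans (min_le_left _ _)).trans_lt (half_lt_self hδ)
      have hdc : d ≤ c := (min_le_left _ _).trans (min_le_right _ _)
      have hdz : d ≤ z / 2 := min_le_right _ _
      have hm : 0 < (z / 2) ^ (N - 1) * c := mul_pos (pow_pos (half_pos hz0) _) hc0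
      refine ⟨d, hd0, (z / 2) ^ (N - 1) * c / 2, half_pos hm, fun h hh => ?_⟩
      have hcont : Continuous fun t : ℝ => t ^ (N - 1) * extCI h t :=
        (continuous_id.pow _).mul (continuous_extCI h)
      have hint : ∀ a b : ℝ, IntervalIntegrable (fun t : ℝ => t ^ (N - 1) * extCI h t)
        volume a b := fun a b => hcont.intervalIntegrable a b
      obtain ⟨w, hw, hlow⟩ := exists_mul_abs_sub_le (c := (z / 2) ^ (N - 1) * c)
        (F := fun s => ∫ t in (0:ℝ)..s, t ^ (N - 1) * extCI h t)
        (U := Set.Icc 0 1 ∩ Metric.closedBall z d)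
        (isCompact_Icc.inter_right Metric.isClosed_closedBall)
        ⟨z, hz, Metric.mem_closedBall_self hd0.le⟩
        (intervalIntegral.continuous_primitive hint 0).continuousOn (by
          intro s hs t ht hts
          have hs' := abs_le.1 (Metric.mem_closedBall.1 hs.2)
          have ht' := abs_le.1 (Metric.mem_closedBall.1 ht.2)
          rw [intervalIntegral.integral_interval_sub_left (hint _ _) (hint _ _)]
          have h1 : ∫ _ in t..s, (z / 2) ^ (N - 1) * c ≤
              σ * ∫ x in t..s, x ^ (N - 1) * extCI h x := by
            rw [← intervalIntegral.integral_const_mul]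
            refine intervalIntegral.integral_mono_on hts intervalIntegrable_const
              ((hint _ _).const_mul _) fun x hx => ?_
            rw [mul_left_comm σ]
            have hxz : z / 2 ≤ x := by linarith [hx.1]
            refine mul_le_mul (pow_le_pow_left₀ (half_pos hz0).le hxz _)
              (key h (hh.trans_le hdc) x ?_) hc0.le (pow_nonneg ((half_pos hz0).le.trans hxz) _)
            rw [abs_lt]
            constructor <;> linarith [hx.1, hx.2]
          rw [intervalIntegral.integral_const, smul_eq_mul, mul_comm] at h1
          refine h1.trans ((le_abs_self _).trans ?_)
          rw [abs_mul, hσ, one_mul])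
      exact ⟨w, hw.1, fun s hs hsz => (hlow s ⟨hs, Metric.mem_closedBall.2 hsz.le⟩).trans
        (abs_integral_pow_mul_le_abs_Jmap N _ hs)⟩

lemma lintegral_abs_rpow_lt_top {e : ℝ} (he : -1 < e) :
    ∫⁻ x in Set.Icc (-1:ℝ) 1, ENNReal.ofReal |x| ^ e < ⊤ := by
  have h1 : IntervalIntegrable (fun x : ℝ => |x| ^ e) volume (-1) 1 := by
    have h2 : ∀ x : ℝ, 0 < x → IntervalIntegrable (fun x : ℝ => |x| ^ e) volume 0 x := by
      intro x hx
      refine (intervalIntegral.intervalIntegrable_rpow' (a := 0) (b := x) he).congr ?_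
      intro y hy
      rw [Set.uIoc_of_le hx.le] at hy
      simp only [abs_of_pos hy.1]
    exact intervalIntegrable_of_even (fun x => by rw [abs_neg]) h2
  rw [intervalIntegrable_iff_integrableOn_Icc_of_le (by norm_num)] at h1
  refine lt_of_eq_of_lt (lintegral_congr_ae ?_) (Integrable.lintegral_lt_top h1)
  filter_upwards [ae_restrict_of_ae (Measure.ae_ne volume (0:ℝ))] with x hx
  exact ENNReal.ofReal_rpow_of_pos (abs_pos.2 hx)

lemma lintegral_abs_sub_rpow_le (e : ℝ) {w : ℝ} (hw : w ∈ Set.Icc (0:ℝ) 1) :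
    ∫⁻ s in Set.Icc (0:ℝ) 1, ENNReal.ofReal |s - w| ^ e ≤
      ∫⁻ x in Set.Icc (-1:ℝ) 1, ENNReal.ofReal |x| ^ e := by
  rw [← lintegral_indicator measurableSet_Icc, ← lintegral_indicator measurableSet_Icc,
    ← lintegral_sub_right_eq_self
      ((Set.Icc (-1:ℝ) 1).indicator fun x => ENNReal.ofReal |x| ^ e) w]
  refine lintegral_mono fun s => ?_
  by_cases hs : s ∈ Set.Icc (0:ℝ) 1
  · have hsw : s - w ∈ Set.Icc (-1:ℝ) 1 := ⟨by linarith [hs.1, hw.2], by linarith [hs.2, hw.1]⟩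
    simp only [Set.indicator_of_mem hs, Set.indicator_of_mem hsw, le_refl]
  · simp only [Set.indicator_of_notMem hs, zero_le]

lemma exists_lintegral_Jmap_rpow_le (N : ℕ) (h₀ : C(Set.Icc (0:ℝ) 1, ℝ))
    (hnd : ∀ r ∈ Set.Icc (0:ℝ) 1, Jmap N (extCI h₀) r = 0 → extCI h₀ r ≠ 0)
    {e : ℝ} (he : -1 < e) (he0 : e ≤ 0) :
    ∃ V ∈ 𝓝 h₀, ∃ M < (⊤ : ENNReal), ∀ h ∈ V,
      ∫⁻ s in Set.Icc (0:ℝ) 1, ENNReal.ofReal |Jmap N (extCI h) s| ^ e ≤ M := by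
  suffices H : ∃ V ∈ 𝓝 h₀, ∃ M < (⊤ : ENNReal), ∀ h ∈ V,
      ∫⁻ s in Set.Icc (0:ℝ) 1 ∩ Set.Icc (0:ℝ) 1,
        ENNReal.ofReal |Jmap N (extCI h) s| ^ e ≤ M by
    rwa [Set.inter_self] at H
  refine isCompact_Icc.induction_on (p := fun U => ∃ V ∈ 𝓝 h₀, ∃ M < (⊤ : ENNReal), ∀ h ∈ V,
      ∫⁻ s in U ∩ Set.Icc (0:ℝ) 1, ENNReal.ofReal |Jmap N (extCI h) s| ^ e ≤ M) ?_ ?_ ?_ ?_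
  · exact ⟨Set.univ, univ_mem, 0, ENNReal.zero_lt_top, fun h _ => by simp⟩
  · rintro U₁ U₂ hU ⟨V, hV, M, hM, h⟩
    exact ⟨V, hV, M, hM, fun k hk =>
      (lintegral_mono_set (Set.inter_subset_inter_left _ hU)).trans (h k hk)⟩
  · rintro U₁ U₂ ⟨V₁, hV₁, M₁, hM₁, h₁⟩ ⟨V₂, hV₂, M₂, hM₂, h₂⟩
    refine ⟨V₁ ∩ V₂, inter_mem hV₁ hV₂, M₁ + M₂, ENNReal.add_lt_top.2 ⟨hM₁, hM₂⟩,
      fun k hk => ?_⟩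
    rw [Set.union_inter_distrib_right]
    exact (lintegral_union_le _ _ _).trans (add_le_add (h₁ k hk.1) (h₂ k hk.2))
  · intro z hz
    obtain ⟨δ, hδ, c, hc, hlow⟩ := exists_local_lower_bound N h₀ hz (hnd z hz)
    refine ⟨Metric.ball z δ, mem_nhdsWithin_of_mem_nhds (Metric.ball_mem_nhds z hδ),
      Metric.ball h₀ δ, Metric.ball_mem_nhds h₀ hδ,
      ENNReal.ofReal c ^ e * ∫⁻ x in Set.Icc (-1:ℝ) 1, ENNReal.ofReal |x| ^ e, ?_, ?_⟩
    · refine ENNReal.mul_lt_top ?_ (lintegral_abs_rpow_lt_top he)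
      rw [ENNReal.ofReal_rpow_of_pos hc]
      exact ENNReal.ofReal_lt_top
    · intro h hh
      obtain ⟨w, hw, hb⟩ := hlow h (by rwa [← dist_eq_norm])
      calc ∫⁻ s in Metric.ball z δ ∩ Set.Icc (0:ℝ) 1,
              ENNReal.ofReal |Jmap N (extCI h) s| ^ e
          ≤ ∫⁻ s in Metric.ball z δ ∩ Set.Icc (0:ℝ) 1,
              ENNReal.ofReal c ^ e * ENNReal.ofReal |s - w| ^ e := by
            refine setLIntegral_mono' (Metric.isOpen_ball.measurableSet.inter measurableSet_Icc)
              fun s hs => ?_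
            rw [← ENNReal.mul_rpow_of_ne_top ENNReal.ofReal_ne_top ENNReal.ofReal_ne_top,
              ← ENNReal.ofReal_mul hc.le]
            rw [← neg_neg e, ENNReal.rpow_neg, ENNReal.rpow_neg _ (-e), ENNReal.inv_le_inv]
            exact ENNReal.rpow_le_rpow (ENNReal.ofReal_le_ofReal (hb s hs.2 hs.1))
              (neg_nonneg.2 he0)
        _ ≤ ∫⁻ s in Set.Icc (0:ℝ) 1, ENNReal.ofReal c ^ e * ENNReal.ofReal |s - w| ^ e :=
            lintegral_mono_set Set.inter_subset_right
        _ = ENNReal.ofReal c ^ e * ∫⁻ s in Set.Icc (0:ℝ) 1, ENNReal.ofReal |s - w| ^ e := by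
            refine lintegral_const_mul _ ?_
            fun_prop
        _ ≤ _ := by
            refine mul_le_mul_right ?_ _
            exact lintegral_abs_sub_rpow_le e hw

/-- The negative powers `|J(h)| ^ e`, `e > -1`, are bounded in `L¹(0,1)` uniformly for `h` close to
a nondegenerate `h₀`. -/
lemma exists_integral_Jmap_rpow_le (N : ℕ) (h₀ : C(Set.Icc (0:ℝ) 1, ℝ))
    (hnd : ∀ r ∈ Set.Icc (0:ℝ) 1, Jmap N (extCI h₀) r = 0 → extCI h₀ r ≠ 0)
    {e : ℝ} (he : -1 < e) (he0 : e < 0) :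
    ∃ V ∈ 𝓝 h₀, ∃ M : ℝ, ∀ h ∈ V,
      (∀ᵐ s ∂volume.restrict (Set.Ioc (0:ℝ) 1), Jmap N (extCI h) s ≠ 0) ∧
      IntegrableOn (fun s => |Jmap N (extCI h) s| ^ e) (Set.Ioc 0 1) ∧
      ∫ s in Set.Ioc (0:ℝ) 1, |Jmap N (extCI h) s| ^ e ≤ M := by
  obtain ⟨V, hV, M, hM, hb⟩ := exists_lintegral_Jmap_rpow_le N h₀ hnd he he0.le
  refine ⟨V, hV, M.toReal, fun h hh => ?_⟩
  have hmJ : Measurable (Jmap N (extCI h)) := (continuous_Jmap N h).measurable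
  have hle : ∫⁻ s in Set.Ioc (0:ℝ) 1, ENNReal.ofReal |Jmap N (extCI h) s| ^ e ≤ M :=
    (lintegral_mono_set Set.Ioc_subset_Icc_self).trans (hb h hh)
  have hne : ∀ᵐ s ∂volume.restrict (Set.Ioc (0:ℝ) 1), Jmap N (extCI h) s ≠ 0 := by
    filter_upwards [ae_lt_top (by fun_prop) (hle.trans_lt hM).ne] with s hs h0
    simp [h0, ENNReal.zero_rpow_of_neg he0] at hs
  have heq : ∫⁻ s in Set.Ioc (0:ℝ) 1, ENNReal.ofReal (|Jmap N (extCI h) s| ^ e) =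
      ∫⁻ s in Set.Ioc (0:ℝ) 1, ENNReal.ofReal |Jmap N (extCI h) s| ^ e := by
    refine lintegral_congr_ae ?_
    filter_upwards [hne] with s hs
    exact (ENNReal.ofReal_rpow_of_pos (abs_pos.2 hs)).symm
  have hm : AEStronglyMeasurable (fun s => |Jmap N (extCI h) s| ^ e)
      (volume.restrict (Set.Ioc (0:ℝ) 1)) := by
    refine Measurable.aestronglyMeasurable ?_
    fun_prop
  have hnn : 0 ≤ᵐ[volume.restrict (Set.Ioc (0:ℝ) 1)] fun s => |Jmap N (extCI h) s| ^ e :=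
    Filter.Eventually.of_forall fun s => Real.rpow_nonneg (abs_nonneg _) _
  refine ⟨hne, ⟨hm, ?_⟩, ?_⟩
  · rw [hasFiniteIntegral_iff_ofReal hnn, heq]
    exact hle.trans_lt hM
  · rw [integral_eq_lintegral_of_nonneg_ae hnn hm, heq]
    exact ENNReal.toReal_mono hM.ne hle

lemma abs_integral_right_le {f : ℝ → ℝ} {r : ℝ} (hf : IntegrableOn f (Set.Ioc 0 1))
    (hr : r ∈ Set.Icc (0:ℝ) 1) :
    |∫ s in r..(1:ℝ), f s| ≤ ∫ s in Set.Ioc (0:ℝ) 1, |f s| := by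
  refine (intervalIntegral.abs_integral_le_integral_abs hr.2).trans ?_
  rw [intervalIntegral.integral_of_le hr.2]
  exact setIntegral_mono_set hf.abs (Filter.Eventually.of_forall fun s => abs_nonneg _)
    (Set.Ioc_subset_Ioc_left hr.1).eventuallyLE

lemma intervalIntegrable_of_integrableOn_Ioc {f : ℝ → ℝ} (hf : IntegrableOn f (Set.Ioc 0 1))
    {a b : ℝ} (ha : a ∈ Set.Icc (0:ℝ) 1) (hb : b ∈ Set.Icc (0:ℝ) 1) :
    IntervalIntegrable f volume a b := by
  have : IntervalIntegrable f volume 0 1 :=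
    (intervalIntegrable_iff_integrableOn_Ioc_of_le zero_le_one).2 hf
  refine this.mono_set ?_
  rw [Set.uIcc_of_le (zero_le_one' ℝ)]
  exact Set.uIcc_subset_Icc ha hb

lemma integrableOn_mul_Jmap (N : ℕ) {w : ℝ → ℝ} (hw : IntegrableOn w (Set.Ioc 0 1))
    (k : C(Set.Icc (0:ℝ) 1, ℝ)) :
    IntegrableOn (fun s => w s * Jmap N (extCI k) s) (Set.Ioc 0 1) := by
  refine Integrable.mul_bdd (c := ‖k‖) hw (continuous_Jmap N k).aestronglyMeasurable ?_
  exact (ae_restrict_iff' measurableSet_Ioc).2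
    (Filter.Eventually.of_forall fun s hs => abs_Jmap_le N k (Set.Ioc_subset_Icc_self hs))

lemma integral_abs_mul_Jmap_le (N : ℕ) {w : ℝ → ℝ} (hw : IntegrableOn w (Set.Ioc 0 1))
    (k : C(Set.Icc (0:ℝ) 1, ℝ)) :
    ∫ s in Set.Ioc (0:ℝ) 1, |w s * Jmap N (extCI k) s| ≤
      (∫ s in Set.Ioc (0:ℝ) 1, |w s|) * ‖k‖ := by
  rw [← MeasureTheory.integral_mul_const]
  refine setIntegral_mono_on (integrableOn_mul_Jmap N hw k).abs (hw.abs.mul_const _)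
    measurableSet_Ioc fun s hs => ?_
  rw [abs_mul]
  exact mul_le_mul_of_nonneg_left (abs_Jmap_le N k (Set.Ioc_subset_Icc_self hs)) (abs_nonneg _)

/-- The operator `k ↦ (r ↦ α ∫_r^1 w J(k))` is bounded on `C([0,1])` for an integrable `w`. -/
lemma exists_clm_integral_mul_Jmap (N : ℕ) (α : ℝ) {w : ℝ → ℝ}
    (hw : IntegrableOn w (Set.Ioc 0 1)) :
    ∃ T : C(Set.Icc (0:ℝ) 1, ℝ) →L[ℝ] C(Set.Icc (0:ℝ) 1, ℝ),
      ∀ k r, T k r = α * ∫ s in (r:ℝ)..1, w s * Jmap N (extCI k) s := by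
  have hcont : ∀ k : C(Set.Icc (0:ℝ) 1, ℝ), Continuous fun r : Set.Icc (0:ℝ) 1 =>
      α * ∫ s in (r:ℝ)..1, w s * Jmap N (extCI k) s := by
    intro k
    have h1 := intervalIntegral.continuousOn_primitive_interval_left (a := 0) (b := 1)
      (f := fun s => w s * Jmap N (extCI k) s) (μ := volume) (by
        rw [Set.uIcc_of_le (zero_le_one' ℝ), integrableOn_Icc_iff_integrableOn_Ioc]
        exact integrableOn_mul_Jmap N hw k)
    rw [Set.uIcc_of_le (zero_le_one' ℝ), continuousOn_iff_continuous_domRestrict] at h1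
    exact continuous_const.mul h1
  have hii : ∀ (k : C(Set.Icc (0:ℝ) 1, ℝ)) (r : Set.Icc (0:ℝ) 1),
      IntervalIntegrable (fun s => w s * Jmap N (extCI k) s) volume r 1 := fun k r =>
    intervalIntegrable_of_integrableOn_Ioc (integrableOn_mul_Jmap N hw k) r.2
      ⟨zero_le_one, le_rfl⟩
  let L : C(Set.Icc (0:ℝ) 1, ℝ) →ₗ[ℝ] C(Set.Icc (0:ℝ) 1, ℝ) :=
    { toFun := fun k => ⟨_, hcont k⟩
      map_add' := fun k l => by
        ext r
        simp only [ContinuousMap.coe_mk, ContinuousMap.add_apply, Jmap_add, mul_add]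
        rw [intervalIntegral.integral_add (hii k r) (hii l r), mul_add]
      map_smul' := fun c k => by
        ext r
        simp only [ContinuousMap.coe_mk, ContinuousMap.smul_apply, Jmap_smul, smul_eq_mul,
          RingHom.id_apply, mul_left_comm _ c]
        rw [intervalIntegral.integral_const_mul, mul_left_comm] }
  refine ⟨L.mkContinuous (|α| * ∫ s in Set.Ioc (0:ℝ) 1, |w s|) fun k => ?_, fun k r => rfl⟩
  rw [ContinuousMap.norm_le _ (mul_nonneg (mul_nonneg (abs_nonneg _)
    (integral_nonneg fun _ => abs_nonneg _)) (norm_nonneg _))]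
  intro r
  change |α * ∫ s in (r:ℝ)..1, w s * Jmap N (extCI k) s| ≤ _
  rw [abs_mul, mul_assoc]
  exact mul_le_mul_of_nonneg_left ((abs_integral_right_le (integrableOn_mul_Jmap N hw k) r.2).trans
    (integral_abs_mul_Jmap_le N hw k)) (abs_nonneg _)

lemma hasFDerivAt_of_norm_sub_le_rpow {E F : Type*} [NormedAddCommGroup E] [NormedSpace ℝ E]
    [NormedAddCommGroup F] [NormedSpace ℝ F] {f : E → F} {f' : E →L[ℝ] F} {x : E} {C θ : ℝ}
    (hθ : 0 < θ) (h : ∀ y, ‖f y - f x - f' (y - x)‖ ≤ C * ‖y - x‖ ^ (1 + θ)) :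
    HasFDerivAt f f' x := by
  rw [hasFDerivAt_iff_tendsto]
  have hlim : Tendsto (fun y => C * ‖y - x‖ ^ θ) (𝓝 x) (𝓝 0) := by
    have hc : Continuous fun y : E => C * ‖y - x‖ ^ θ :=
      continuous_const.mul ((continuous_id.sub continuous_const).norm.rpow_const
        fun _ => Or.inr hθ.le)
    simpa [Real.zero_rpow hθ.ne'] using hc.tendsto x
  refine squeeze_zero' (Filter.Eventually.of_forall fun y => by positivity)
    (Filter.Eventually.of_forall fun y => ?_) hlim
  rcases eq_or_ne y x with rfl | hy
  · simp [Real.zero_rpow hθ.ne']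
  · have hpos : 0 < ‖y - x‖ := norm_pos_iff.2 (sub_ne_zero.2 hy)
    refine (mul_le_mul_of_nonneg_left (h y) (inv_nonneg.2 hpos.le)).trans_eq ?_
    rw [Real.rpow_add hpos, Real.rpow_one]
    field_simp

lemma continuousOn_of_norm_sub_le_rpow {E F : Type*} [NormedAddCommGroup E]
    [NormedAddCommGroup F] {f : E → F} {s : Set E} {C θ : ℝ} (hθ : 0 < θ)
    (h : ∀ x ∈ s, ∀ y ∈ s, ‖f y - f x‖ ≤ C * ‖y - x‖ ^ θ) : ContinuousOn f s := by
  intro x hx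
  rw [ContinuousWithinAt, tendsto_iff_norm_sub_tendsto_zero]
  have hc : Continuous fun y : E => C * ‖y - x‖ ^ θ :=
    continuous_const.mul ((continuous_id.sub continuous_const).norm.rpow_const
      fun _ => Or.inr hθ.le)
  have hlim : Tendsto (fun y => C * ‖y - x‖ ^ θ) (𝓝[s] x) (𝓝 0) := by
    simpa [Real.zero_rpow hθ.ne'] using (hc.tendsto x).mono_left nhdsWithin_le_nhds
  exact squeeze_zero' (Filter.Eventually.of_forall fun y => norm_nonneg _)
    (eventually_mem_nhdsWithin.mono fun y hy => h x hx y hy) hlim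

lemma abs_rpow_le_one_add {e e' : ℝ} (he : e < 0) (he' : e' ≤ e) (x : ℝ) :
    |x| ^ e ≤ 1 + |x| ^ e' := by
  rcases eq_or_ne x 0 with rfl | hx
  · rw [abs_zero, Real.zero_rpow he.ne, Real.zero_rpow (he'.trans_lt he).ne]
    norm_num
  · have hx' := abs_pos.2 hx
    rcases le_total |x| 1 with h | h
    · linarith [Real.rpow_le_rpow_of_exponent_ge hx' h he']
    · linarith [Real.rpow_le_one_of_one_le_of_nonpos h he.le, Real.rpow_nonneg hx'.le e']

lemma integrableOn_Jmap_rpow (N : ℕ) (h : C(Set.Icc (0:ℝ) 1, ℝ)) {e e' : ℝ} (he : e < 0)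
    (he' : e' ≤ e) (hi : IntegrableOn (fun s => |Jmap N (extCI h) s| ^ e') (Set.Ioc 0 1)) :
    IntegrableOn (fun s => |Jmap N (extCI h) s| ^ e) (Set.Ioc 0 1) := by
  have hmJ : Measurable (Jmap N (extCI h)) := (continuous_Jmap N h).measurable
  have hm : Measurable fun s => |Jmap N (extCI h) s| ^ e := by fun_prop
  have hone : IntegrableOn (fun _ : ℝ => (1:ℝ)) (Set.Ioc 0 1) := integrableOn_const (by simp)
  refine Integrable.mono' (hone.add hi) hm.aestronglyMeasurable
    (Filter.Eventually.of_forall fun s => ?_)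
  rw [Real.norm_of_nonneg (Real.rpow_nonneg (abs_nonneg _) _)]
  exact abs_rpow_le_one_add he he' _

/-- Hölder continuity of `h ↦ |J(h)| ^ (α - 1)` into `L¹(0,1)`. -/
lemma integral_abs_Jmap_rpow_sub_le (N : ℕ) {α θ M : ℝ} (hα : 0 < α) (hα1 : α < 1) (hθ : 0 < θ)
    (hθ1 : θ ≤ 1) (g h : C(Set.Icc (0:ℝ) 1, ℝ))
    (hg : IntegrableOn (fun s => |Jmap N (extCI g) s| ^ (α - 1 - θ)) (Set.Ioc 0 1))
    (hgM : ∫ s in Set.Ioc (0:ℝ) 1, |Jmap N (extCI g) s| ^ (α - 1 - θ) ≤ M)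
    (hh : IntegrableOn (fun s => |Jmap N (extCI h) s| ^ (α - 1 - θ)) (Set.Ioc 0 1))
    (hhM : ∫ s in Set.Ioc (0:ℝ) 1, |Jmap N (extCI h) s| ^ (α - 1 - θ) ≤ M) :
    ∫ s in Set.Ioc (0:ℝ) 1,
      |(|Jmap N (extCI g) s| ^ (α - 1) - |Jmap N (extCI h) s| ^ (α - 1))| ≤
        2 * M * ‖g - h‖ ^ θ := by
  have hgi := integrableOn_Jmap_rpow N g (by linarith : α - 1 < 0) (by linarith) hg
  have hhi := integrableOn_Jmap_rpow N h (by linarith : α - 1 < 0) (by linarith) hh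
  calc _ ≤ ∫ s in Set.Ioc (0:ℝ) 1, ‖g - h‖ ^ θ *
        (|Jmap N (extCI g) s| ^ (α - 1 - θ) + |Jmap N (extCI h) s| ^ (α - 1 - θ)) := by
        refine setIntegral_mono_on (hgi.sub hhi).abs ((hg.add hh).const_mul _) measurableSet_Ioc
          fun s hs => ?_
        have h1 := abs_rpow_neg_sub_le (q := 1 - α) (by linarith) (by linarith) hθ hθ1
          (Jmap N (extCI g) s) (Jmap N (extCI h) s)
        rw [neg_sub] at h1
        refine h1.trans (mul_le_mul_of_nonneg_right ?_ (by positivity))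
        rw [← Jmap_sub]
        exact Real.rpow_le_rpow (abs_nonneg _)
          (abs_Jmap_le N _ (Set.Ioc_subset_Icc_self hs)) hθ.le
    _ = ‖g - h‖ ^ θ * ((∫ s in Set.Ioc (0:ℝ) 1, |Jmap N (extCI g) s| ^ (α - 1 - θ)) +
        ∫ s in Set.Ioc (0:ℝ) 1, |Jmap N (extCI h) s| ^ (α - 1 - θ)) := by
        rw [MeasureTheory.integral_const_mul, MeasureTheory.integral_add hg hh]
    _ ≤ ‖g - h‖ ^ θ * (M + M) := by gcongr
    _ = _ := by ring

/-- First-order Taylor estimate for the superposition operator `h ↦ φ(J(h))` in `L¹(0,1)`. -/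
lemma integral_abs_phi_Jmap_sub_taylor_le (N : ℕ) {α θ M : ℝ} (hα : 0 < α) (hα1 : α < 1)
    (hθ : 0 < θ) (hθ1 : θ ≤ 1) (g h : C(Set.Icc (0:ℝ) 1, ℝ))
    (hne : ∀ᵐ s ∂volume.restrict (Set.Ioc (0:ℝ) 1), Jmap N (extCI h) s ≠ 0)
    (hh : IntegrableOn (fun s => |Jmap N (extCI h) s| ^ (α - 1 - θ)) (Set.Ioc 0 1))
    (hhM : ∫ s in Set.Ioc (0:ℝ) 1, |Jmap N (extCI h) s| ^ (α - 1 - θ) ≤ M) :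
    ∫ s in Set.Ioc (0:ℝ) 1,
      |(|Jmap N (extCI g) s| ^ (α - 1) * Jmap N (extCI g) s
        - |Jmap N (extCI h) s| ^ (α - 1) * Jmap N (extCI h) s
        - α * (|Jmap N (extCI h) s| ^ (α - 1) * Jmap N (extCI (g - h)) s))| ≤
        5 * M * ‖g - h‖ ^ (1 + θ) := by
  calc _ ≤ ∫ s in Set.Ioc (0:ℝ) 1, 5 * ‖g - h‖ ^ (1 + θ) *
        |Jmap N (extCI h) s| ^ (α - 1 - θ) := by
        refine integral_mono_of_nonneg (Filter.Eventually.of_forall fun s => abs_nonneg _)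
          (hh.const_mul _) ?_
        filter_upwards [hne, ae_restrict_mem measurableSet_Ioc] with s hs hs1
        simp only [Jmap_sub]
        refine (abs_phi_sub_taylor_le hα hα1 hθ.le hθ1 hs _).trans ?_
        rw [mul_assoc, ← Jmap_sub]
        have := abs_Jmap_le N (g - h) (Set.Ioc_subset_Icc_self hs1)
        gcongr
    _ = 5 * ‖g - h‖ ^ (1 + θ) * ∫ s in Set.Ioc (0:ℝ) 1,
        |Jmap N (extCI h) s| ^ (α - 1 - θ) := MeasureTheory.integral_const_mul _ _
    _ ≤ 5 * ‖g - h‖ ^ (1 + θ) * M := by gcongr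
    _ = _ := by ring

/-- for `p > 2` and `h₀` such that `S_p(h₀)'(r) = 0 ⟹ h₀(r) ≠ 0`, there is a
neighborhood `V₀` of `h₀` on which `h ↦ |S_p(h)'|^(2-p)` is a continuous map into
`L¹(0,1)`, `S_p` is continuously Fréchet differentiable with the stated formula for
the derivative, and each `v = DS_p(h)h̄` is absolutely continuous. -/
theorem stmt_5 (p : ℝ) (hp : 2 < p) (N : ℕ) (hN : 1 ≤ N)
    (h₀ : C(Set.Icc (0:ℝ) 1, ℝ))
    (hnd : ∀ r ∈ Set.Icc (0:ℝ) 1, deriv01 (Sp p N (extCI h₀)) r = 0 → extCI h₀ r ≠ 0) :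
    ∃ V₀ ∈ nhds h₀,
      -- (a) integrability and L¹-continuity of h ↦ |S_p(h)'|^(2-p)
      (∀ h ∈ V₀, IntegrableOn
          (fun t => |deriv01 (Sp p N (extCI h)) t| ^ (2 - p)) (Set.Ioo (0:ℝ) 1)) ∧
      (∀ h ∈ V₀, ∀ ε > 0, ∃ δ > 0, ∀ g ∈ V₀, ‖g - h‖ < δ →
        (∫ t in Set.Ioo (0:ℝ) 1,
          |(|deriv01 (Sp p N (extCI g)) t| ^ (2 - p)
            - |deriv01 (Sp p N (extCI h)) t| ^ (2 - p))|) < ε) ∧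
      -- (b) S_p is C¹ on V₀ with the stated derivative
      (∃ (S : C(Set.Icc (0:ℝ) 1, ℝ) → C(Set.Icc (0:ℝ) 1, ℝ))
        (DS : C(Set.Icc (0:ℝ) 1, ℝ) → C(Set.Icc (0:ℝ) 1, ℝ) →L[ℝ] C(Set.Icc (0:ℝ) 1, ℝ)),
        (∀ (h : C(Set.Icc (0:ℝ) 1, ℝ)) (r : Set.Icc (0:ℝ) 1), S h r = Sp p N (extCI h) r) ∧
        (∀ h ∈ V₀, HasFDerivAt S (DS h) h) ∧
        ContinuousOn DS V₀ ∧
        (∀ h ∈ V₀, ∀ (hbar : C(Set.Icc (0:ℝ) 1, ℝ)) (r : Set.Icc (0:ℝ) 1),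
          DS h hbar r = (1 / (p - 1)) *
            ∫ s in (r:ℝ)..1,
              |deriv01 (Sp p N (extCI h)) s| ^ (2 - p) * Jmap N (extCI hbar) s)) ∧
      -- (c) absolute continuity of v = DS_p(h) h̄
      (∀ h ∈ V₀, ∀ hbar : C(Set.Icc (0:ℝ) 1, ℝ),
        IntegrableOn
          (fun t => -((1 / (p - 1)) * |deriv01 (Sp p N (extCI h)) t| ^ (2 - p)
            * Jmap N (extCI hbar) t)) (Set.Ioo (0:ℝ) 1) ∧
        ∀ r ∈ Set.Icc (0:ℝ) 1,
          ((1 / (p - 1)) * ∫ s in r..(1:ℝ),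
              |deriv01 (Sp p N (extCI h)) s| ^ (2 - p) * Jmap N (extCI hbar) s)
          = ((1 / (p - 1)) * ∫ s in (0:ℝ)..1,
              |deriv01 (Sp p N (extCI h)) s| ^ (2 - p) * Jmap N (extCI hbar) s)
            + ∫ t in (0:ℝ)..r,
                -((1 / (p - 1)) * |deriv01 (Sp p N (extCI h)) t| ^ (2 - p)
                  * Jmap N (extCI hbar) t)) := by

  set α : ℝ := 1 / (p - 1) with hαdef
  have hα : 0 < α := one_div_pos.mpr (by linarith)
  have hα1 : α < 1 := (div_lt_one (by linarith)).2 (by linarith)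
  set θ : ℝ := α / 2 with hθdef
  have hθ : 0 < θ := half_pos hα
  have hθ1 : θ ≤ 1 := by linarith
  have hndJ : ∀ r ∈ Set.Icc (0:ℝ) 1, Jmap N (extCI h₀) r = 0 → extCI h₀ r ≠ 0 := fun r hr h =>
    hnd r hr (by rw [deriv01_Sp hp N h₀ hr, h]; simp [phi])
  obtain ⟨V, hV, M, hVM⟩ := exists_integral_Jmap_rpow_le N h₀ hndJ
    (e := α - 1 - θ) (by linarith) (by linarith)
  have hM : 0 ≤ M := (integral_nonneg fun s => Real.rpow_nonneg (abs_nonneg _) _).trans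
    (hVM h₀ (mem_of_mem_nhds hV)).2.2
  have hW : ∀ h : C(Set.Icc (0:ℝ) 1, ℝ), ∀ s ∈ Set.Ioc (0:ℝ) 1,
      |deriv01 (Sp p N (extCI h)) s| ^ (2 - p) = |Jmap N (extCI h) s| ^ (α - 1) :=
    fun h s hs => abs_deriv01_Sp_rpow hp N h (Set.Ioc_subset_Icc_self hs)
  have hint : ∀ h ∈ V, IntegrableOn
      (fun t => |deriv01 (Sp p N (extCI h)) t| ^ (2 - p)) (Set.Ioc (0:ℝ) 1) := fun h hh =>
    (integrableOn_congr_fun (hW h) measurableSet_Ioc).2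
      (integrableOn_Jmap_rpow N h (by linarith) (by linarith) (hVM h hh).2.1)
  have hL1 : ∀ h ∈ V, ∀ g ∈ V, ∫ t in Set.Ioc (0:ℝ) 1,
      |(|deriv01 (Sp p N (extCI g)) t| ^ (2 - p)
        - |deriv01 (Sp p N (extCI h)) t| ^ (2 - p))| ≤ 2 * M * ‖g - h‖ ^ θ := by
    intro h hh g hg
    rw [setIntegral_congr_fun measurableSet_Ioc fun s hs => by rw [hW g s hs, hW h s hs]]
    exact integral_abs_Jmap_rpow_sub_le N hα hα1 hθ hθ1 g h (hVM g hg).2.1 (hVM g hg).2.2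
      (hVM h hh).2.1 (hVM h hh).2.2
  refine ⟨V, hV, fun h hh => (hint h hh).mono_set Set.Ioo_subset_Ioc_self, ?_, ?_, ?_⟩
  · intro h hh ε hε
    have hc : Continuous fun x : ℝ => 2 * M * |x| ^ θ :=
      continuous_const.mul (continuous_abs.rpow_const fun _ => Or.inr hθ.le)
    obtain ⟨δ, hδ, hδε⟩ := Metric.continuousAt_iff.1 (hc.continuousAt (x := 0)) ε hε
    refine ⟨δ, hδ, fun g hg hgh => ?_⟩
    rw [← integral_Ioc_eq_integral_Ioo]
    have h1 := hδε (x := ‖g - h‖) (by simpa using hgh)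
    rw [abs_zero, Real.zero_rpow hθ.ne', mul_zero, Real.dist_eq, sub_zero, abs_norm] at h1
    exact (hL1 h hh g hg).trans_lt ((le_abs_self _).trans_lt h1)
  · have hS : ∀ h : C(Set.Icc (0:ℝ) 1, ℝ), ∃ k : C(Set.Icc (0:ℝ) 1, ℝ), ∀ r : Set.Icc (0:ℝ) 1,
        k r = Sp p N (extCI h) r := fun h =>
      ⟨⟨fun r => Sp p N (extCI h) r, (continuous_iff_continuousAt.2 fun r =>
        (hasDerivAt_Sp hp N h r).continuousAt).comp continuous_subtype_val⟩, fun r => rfl⟩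
    have hDS : ∀ h : C(Set.Icc (0:ℝ) 1, ℝ),
        ∃ T : C(Set.Icc (0:ℝ) 1, ℝ) →L[ℝ] C(Set.Icc (0:ℝ) 1, ℝ), h ∈ V → ∀ k r,
          T k r = α * ∫ s in (r:ℝ)..1,
            |deriv01 (Sp p N (extCI h)) s| ^ (2 - p) * Jmap N (extCI k) s := by
      intro h
      by_cases hh : h ∈ V
      · obtain ⟨T, hT⟩ := exists_clm_integral_mul_Jmap N α (hint h hh)
        exact ⟨T, fun _ => hT⟩
      · exact ⟨0, fun h' => absurd h' hh⟩
    choose S hS using hS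
    choose DS hDS using hDS
    refine ⟨S, DS, hS, fun h hh => ?_, ?_, hDS⟩
    · refine hasFDerivAt_of_norm_sub_le_rpow (C := 5 * M) hθ fun g => ?_
      rw [ContinuousMap.norm_le _ (by positivity)]
      intro r
      have hphi : ∀ k : C(Set.Icc (0:ℝ) 1, ℝ), Continuous fun s =>
          phi (p / (p - 1)) (Jmap N (extCI k) s) := continuous_phi_Jmap hp N
      have hmul := integrableOn_mul_Jmap N (hint h hh) (g - h)
      have hr1 : (1:ℝ) ∈ Set.Icc (0:ℝ) 1 := ⟨zero_le_one, le_rfl⟩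
      have e1 : (S g - S h - DS h (g - h)) r = ∫ s in (r:ℝ)..1,
          (phi (p / (p - 1)) (Jmap N (extCI g) s) - phi (p / (p - 1)) (Jmap N (extCI h) s)
            - α * (|deriv01 (Sp p N (extCI h)) s| ^ (2 - p) * Jmap N (extCI (g - h)) s)) := by
        have hsub : Continuous fun s => phi (p / (p - 1)) (Jmap N (extCI g) s)
            - phi (p / (p - 1)) (Jmap N (extCI h) s) := (hphi g).sub (hphi h)
        rw [intervalIntegral.integral_sub (hsub.intervalIntegrable _ _)
          ((intervalIntegrable_of_integrableOn_Ioc hmul r.2 hr1).const_mul _),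
          intervalIntegral.integral_sub ((hphi g).intervalIntegrable _ _)
            ((hphi h).intervalIntegrable _ _), intervalIntegral.integral_const_mul]
        simp only [ContinuousMap.sub_apply, hS, hDS h hh]
        rfl
      rw [e1, Real.norm_eq_abs]
      have hi : IntegrableOn (fun s =>
          phi (p / (p - 1)) (Jmap N (extCI g) s) - phi (p / (p - 1)) (Jmap N (extCI h) s)
            - α * (|deriv01 (Sp p N (extCI h)) s| ^ (2 - p) * Jmap N (extCI (g - h)) s))
          (Set.Ioc 0 1) :=
        ((hphi g).integrableOn_Ioc.sub (hphi h).integrableOn_Ioc).sub (hmul.const_mul α)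
      refine (abs_integral_right_le hi r.2).trans ?_
      rw [setIntegral_congr_fun measurableSet_Ioc fun s hs => by
        rw [hW h s hs, phi_eq hp, phi_eq hp]]
      exact integral_abs_phi_Jmap_sub_taylor_le N hα hα1 hθ hθ1 g h (hVM h hh).1
        (hVM h hh).2.1 (hVM h hh).2.2
    · refine continuousOn_of_norm_sub_le_rpow (E := C(Set.Icc (0:ℝ) 1, ℝ))
        (F := C(Set.Icc (0:ℝ) 1, ℝ) →L[ℝ] C(Set.Icc (0:ℝ) 1, ℝ)) (C := α * (2 * M)) hθ fun h hh g hg => ?_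
      refine ContinuousLinearMap.opNorm_le_bound _ (by positivity) fun k => ?_
      rw [ContinuousMap.norm_le _ (by positivity)]
      intro r
      have hr1 : (1:ℝ) ∈ Set.Icc (0:ℝ) 1 := ⟨zero_le_one, le_rfl⟩
      have hsub := (hint g hg).sub (hint h hh)
      have e1 : ((DS g - DS h) k) r = α * ∫ s in (r:ℝ)..1,
          (|deriv01 (Sp p N (extCI g)) s| ^ (2 - p) - |deriv01 (Sp p N (extCI h)) s| ^ (2 - p))
            * Jmap N (extCI k) s := by
        simp only [sub_mul]
        rw [intervalIntegral.integral_sub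
          (intervalIntegrable_of_integrableOn_Ioc (integrableOn_mul_Jmap N (hint g hg) k) r.2 hr1)
          (intervalIntegrable_of_integrableOn_Ioc (integrableOn_mul_Jmap N (hint h hh) k) r.2 hr1),
          mul_sub, ← hDS g hg, ← hDS h hh]
        rfl
      rw [e1, Real.norm_eq_abs, abs_mul, abs_of_pos hα, mul_assoc, mul_assoc]
      refine mul_le_mul_of_nonneg_left ?_ hα.le
      refine (abs_integral_right_le (integrableOn_mul_Jmap N hsub k) r.2).trans
        ((integral_abs_mul_Jmap_le N hsub k).trans ?_)
      rw [← mul_assoc]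
      exact mul_le_mul_of_nonneg_right (hL1 h hh g hg) (norm_nonneg _)
  · intro h hh k
    have hmul := integrableOn_mul_Jmap N (hint h hh) k
    have hii : ∀ a ∈ Set.Icc (0:ℝ) 1, ∀ b ∈ Set.Icc (0:ℝ) 1, IntervalIntegrable (fun s =>
        |deriv01 (Sp p N (extCI h)) s| ^ (2 - p) * Jmap N (extCI k) s) volume a b :=
      fun a ha b hb => intervalIntegrable_of_integrableOn_Ioc hmul ha hb
    simp only [mul_assoc]
    refine ⟨IntegrableOn.mono_set (hmul.const_mul α).neg Set.Ioo_subset_Ioc_self, fun r hr => ?_⟩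
    rw [intervalIntegral.integral_neg, intervalIntegral.integral_const_mul,
      ← intervalIntegral.integral_add_adjacent_intervals
        (hii 0 ⟨le_rfl, zero_le_one⟩ r hr) (hii r hr 1 ⟨zero_le_one, le_rfl⟩)]
    ring
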